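/- arXiv:1412.5025 — 2 statements merged into one kernel-verified Lean document; each statement's English description precedes it below -/
import Mathlib

section
/- Let c ≥ 0 be a real number and let π be a Borel probability measure on ℓ¹ concentrated on the cone of nonnegative sequences with ∫_{ℓ¹} ‖q‖_{ℓ¹} dπ(q) < ∞. Assume that for every integer N ≥ 1 and every function G ∈ C²(ℝ^N) with G(0) = 0 whose partial derivatives ∂_0 G, …, ∂_{N−1} G are each continuously differentiable with compact support, one has ∫_{ℓ¹} ∑_{n=0}^{N−1} ∂_n G(q_0,…,q_{N−1})·(J_{n−1}(q) − J_n(q)) dπ(q) = 0. Then for every integer n ≥ 0, every integer M ≥ 1 and every continuously differentiable compactly supported F : ℝ^M → ℝ, one has ∫_{ℓ¹} F(q_0,…,q_{M−1})·J_n(q) dπ(q) = 0. -/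
open MeasureTheory Filter

/-- The Banach space `ℓ¹` of real summable sequences indexed by `ℕ`. -/
noncomputable abbrev EllOne : Type := lp (fun _ : ℕ => ℝ) 1

noncomputable instance : MeasurableSpace EllOne := borel _
noncomputable instance : BorelSpace EllOne := ⟨rfl⟩

/-- The `n`-th coordinate of an element of `ℓ¹`. -/
noncomputable def coords (q : EllOne) : ℕ → ℝ := fun n => q n

/-- The Becker–Döring flux `J_n(q) = a_n · c · q_n − b_{n+1} · q_{n+1}`,
with `a_n = ā (n+2)^r` and `b_n = b̄ (n+2)^r`. -/
noncomputable def fluxJ (abar bbar r c : ℝ) (q : ℕ → ℝ) (n : ℕ) : ℝ :=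
  abar * ((n : ℝ) + 2) ^ r * c * q n - bbar * ((n : ℝ) + 3) ^ r * q (n + 1)

/-- `J_{n-1}`, with the convention `J_{-1} = 0`. -/
noncomputable def fluxJprev (abar bbar r c : ℝ) (q : ℕ → ℝ) : ℕ → ℝ
  | 0 => 0
  | n + 1 => fluxJ abar bbar r c q n

namespace BD

lemma continuous_coords (n : ℕ) : Continuous (fun q : EllOne => coords q n) := by
  have h : LipschitzWith 1 (fun q : EllOne => coords q n) := by
    apply LipschitzWith.of_dist_le_mul
    intro x y
    have := lp.norm_apply_le_norm (p := 1) one_ne_zero (x - y) n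
    simpa [dist_eq_norm, coords] using this
  exact h.continuous

lemma abs_coords_le (q : EllOne) (n : ℕ) : |coords q n| ≤ ‖q‖ := by
  have := lp.norm_apply_le_norm (p := 1) one_ne_zero q n
  simpa [coords] using this

lemma integrable_norm (π : Measure EllOne) (h : (∫⁻ q : EllOne, (‖q‖₊ : ENNReal) ∂π) ≠ ⊤) :
    Integrable (fun q : EllOne => ‖q‖) π := by
  refine ⟨continuous_norm.measurable.aestronglyMeasurable, ?_⟩
  rw [hasFiniteIntegral_iff_enorm]
  simp only [enorm_norm]
  exact lt_top_iff_ne_top.2 h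

lemma integrable_coords (π : Measure EllOne) (h : (∫⁻ q : EllOne, (‖q‖₊ : ENNReal) ∂π) ≠ ⊤)
    (n : ℕ) : Integrable (fun q : EllOne => coords q n) π :=
  (integrable_norm π h).mono' (continuous_coords n).measurable.aestronglyMeasurable
    (Eventually.of_forall fun q => by simpa using abs_coords_le q n)

lemma integrable_flux (a b r c : ℝ) (π : Measure EllOne)
    (h : (∫⁻ q : EllOne, (‖q‖₊ : ENNReal) ∂π) ≠ ⊤)
    (n : ℕ) : Integrable (fun q : EllOne => fluxJ a b r c (coords q) n) π :=
  ((integrable_coords π h n).const_mul _).sub ((integrable_coords π h (n+1)).const_mul _)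

lemma integrable_prev (a b r c : ℝ) (π : Measure EllOne)
    (h : (∫⁻ q : EllOne, (‖q‖₊ : ENNReal) ∂π) ≠ ⊤)
    (n : ℕ) : Integrable (fun q : EllOne => fluxJprev a b r c (coords q) n) π := by
  cases n with
  | zero => simp [fluxJprev]
  | succ n => exact integrable_flux a b r c π h n

/-- One-variable test functions with bounded derivative are admissible. -/
lemma one_var (a b r c : ℝ) (π : Measure EllOne)
    (hmom : (∫⁻ q : EllOne, (‖q‖₊ : ENNReal) ∂π) ≠ ⊤)
    (hstat : ∀ N : ℕ, 1 ≤ N → ∀ G : (Fin N → ℝ) → ℝ,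
      ContDiff ℝ 2 G → G 0 = 0 →
      (∀ n : Fin N,
        ContDiff ℝ 1 (fun x : Fin N → ℝ => fderiv ℝ G x (Pi.single n 1)) ∧
        HasCompactSupport (fun x : Fin N → ℝ => fderiv ℝ G x (Pi.single n 1))) →
      ∫ q, (∑ n : Fin N,
          fderiv ℝ G (fun i : Fin N => coords q (i : ℕ)) (Pi.single n 1) *
            (fluxJprev a b r c (coords q) (n : ℕ) -
              fluxJ a b r c (coords q) (n : ℕ))) ∂π = 0)
    (n : ℕ) (g g' : ℝ → ℝ) (hg : ContDiff ℝ 2 g) (hg' : ∀ x, HasDerivAt g (g' x) x)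
    (h0 : g 0 = 0) (hb : ∀ x, |g' x| ≤ 1) :
    ∫ q, g' (coords q n) * (fluxJprev a b r c (coords q) n - fluxJ a b r c (coords q) n) ∂π = 0 := by
  have hgl : ∀ x, |g x| ≤ |x| := by
    intro x
    have := Convex.norm_image_sub_le_of_norm_hasDerivWithin_le (f := g) (f' := g') (s := Set.univ)
      (x := 0) (y := x) (C := 1)
      (fun y _ => (hg' y).hasDerivWithinAt) (fun y _ => by simpa using hb y) convex_univ
      trivial trivial
    simpa [h0] using this
  let χ : ContDiffBump (0 : Fin (n+1) → ℝ) := ⟨1, 2, one_pos, one_lt_two⟩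
  have hχ2 : ContDiff ℝ 2 (χ : (Fin (n+1) → ℝ) → ℝ) := χ.contDiff
  have hχd : ∀ x, HasFDerivAt (χ : (Fin (n+1) → ℝ) → ℝ) (fderiv ℝ χ x) x := fun x =>
    ((hχ2.differentiable (by norm_num)) x).hasFDerivAt
  have hcont : Continuous (fderiv ℝ (χ : (Fin (n+1) → ℝ) → ℝ)) := hχ2.continuous_fderiv (by norm_num)
  have hcs : HasCompactSupport (fderiv ℝ (χ : (Fin (n+1) → ℝ) → ℝ)) := χ.hasCompactSupport.fderiv ℝ
  obtain ⟨C, hC⟩ := hcont.bounded_above_of_compact_support hcs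
  have hC0 : 0 ≤ C := (norm_nonneg _).trans (hC 0)
  let l : Fin (n+1) := Fin.last n
  let G : ℕ → (Fin (n+1) → ℝ) → ℝ := fun k x => g (x l) * χ (((k:ℝ)+1)⁻¹ • x)
  have hG2 : ∀ k, ContDiff ℝ 2 (G k) := by
    intro k
    refine ContDiff.mul (hg.comp (contDiff_apply ℝ ℝ l)) (hχ2.comp ?_)
    exact contDiff_const_smul _
  have hGd : ∀ k x (m : Fin (n+1)), fderiv ℝ (G k) x (Pi.single m 1) =
      g (x l) * (((k:ℝ)+1)⁻¹ * fderiv ℝ χ (((k:ℝ)+1)⁻¹ • x) (Pi.single m 1))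
      + χ (((k:ℝ)+1)⁻¹ • x) * (g' (x l) * (Pi.single m 1 : Fin (n+1) → ℝ) l) := by
    intro k x m
    have h1 : HasFDerivAt (fun x : Fin (n+1) → ℝ => g (x l))
        (g' (x l) • (ContinuousLinearMap.proj (R := ℝ) (φ := fun _ => ℝ) l)) x :=
      (hg' (x l)).comp_hasFDerivAt x (hasFDerivAt_apply l x)
    have h2 : HasFDerivAt (fun x : Fin (n+1) → ℝ => χ (((k:ℝ)+1)⁻¹ • x))
        ((fderiv ℝ χ (((k:ℝ)+1)⁻¹ • x)).comp (((k:ℝ)+1)⁻¹ • ContinuousLinearMap.id ℝ _)) x :=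
      HasFDerivAt.comp (f := fun y : Fin (n+1) → ℝ => ((k:ℝ)+1)⁻¹ • y) x (hχd _)
        (((k:ℝ)+1)⁻¹ • ContinuousLinearMap.id ℝ (Fin (n+1) → ℝ)).hasFDerivAt
    have h3 := (h1.mul h2).fderiv
    have : fderiv ℝ (G k) x = _ := h3
    rw [this]
    simp
  have hGcs : ∀ k, HasCompactSupport (G k) := by
    intro k
    refine HasCompactSupport.mul_left ?_
    have hk : ((k:ℝ)+1)⁻¹ ≠ 0 := by positivity
    exact χ.hasCompactSupport.comp_homeomorph (Homeomorph.smulOfNeZero _ hk)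
  have key := fun k => hstat (n+1) (by omega) (G k) (hG2 k) (by simp [G, h0]) (by
    intro m
    constructor
    · exact ((hG2 k).fderiv_right (m := 1) (by norm_num)).clm_apply contDiff_const
    · exact ((hGcs k).fderiv ℝ).comp_left (g := fun L : (Fin (n+1) → ℝ) →L[ℝ] ℝ => L (Pi.single m 1)) (by simp))
  let v : ℕ → EllOne → ℝ := fun m q => fluxJprev a b r c (coords q) m - fluxJ a b r c (coords q) m
  have hv : ∀ m, Integrable (v m) π := fun m =>
    (integrable_prev a b r c π hmom m).sub (integrable_flux a b r c π hmom m)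
  have hcc : Continuous (fun q : EllOne => (fun i : Fin (n+1) => coords q (i:ℕ))) :=
    continuous_pi fun i => continuous_coords _
  have hlim : Tendsto (fun k => ∫ q, (∑ m : Fin (n+1),
          fderiv ℝ (G k) (fun i : Fin (n+1) => coords q (i : ℕ)) (Pi.single m 1) * v m q) ∂π) atTop
      (nhds (∫ q, g' (coords q n) * v n q ∂π)) := by
    refine tendsto_integral_of_dominated_convergence
      (fun q => ∑ m : Fin (n+1), (2 * C + 1) * |v m q|) ?_ ?_ ?_ ?_
    · intro k
      refine Finset.aestronglyMeasurable_fun_sum _ fun m _ => ?_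
      refine AEStronglyMeasurable.mul ?_ (hv m).aestronglyMeasurable
      have : Continuous (fun x => fderiv ℝ (G k) x (Pi.single m 1)) :=
        ((hG2 k).continuous_fderiv (by norm_num)).clm_apply continuous_const
      exact (this.comp hcc).measurable.aestronglyMeasurable
    · exact integrable_finsetSum _ fun m _ => (hv m).abs.const_mul _
    · intro k
      refine Eventually.of_forall fun q => ?_
      refine (norm_sum_le _ _).trans (Finset.sum_le_sum fun m _ => ?_)
      rw [norm_mul, Real.norm_eq_abs, Real.norm_eq_abs]
      refine mul_le_mul_of_nonneg_right ?_ (abs_nonneg _)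
      suffices H : ∀ x, |fderiv ℝ (G k) x (Pi.single m 1)| ≤ 2 * C + 1 from H _
      intro x
      rw [hGd]
      have hk : (0:ℝ) < (k:ℝ)+1 := by positivity
      have hs1 : |(Pi.single m 1 : Fin (n+1) → ℝ) l| ≤ 1 := by
        by_cases h : l = m
        · subst h; simp
        · simp [h]
      have hsn : ‖(Pi.single m 1 : Fin (n+1) → ℝ)‖ ≤ 1 := by simp [Pi.norm_single]
      refine (abs_add_le _ _).trans (add_le_add ?_ ?_)
      · by_cases hx : ‖((k:ℝ)+1)⁻¹ • x‖ ≤ 2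
        · have hx' : ((k:ℝ)+1)⁻¹ * ‖x‖ ≤ 2 := by
            rwa [norm_smul, Real.norm_eq_abs, abs_of_pos (inv_pos.2 hk)] at hx
          have h1 : |g (x l)| ≤ ‖x‖ := (hgl _).trans (norm_le_pi_norm x l)
          have h2 : |fderiv ℝ χ (((k:ℝ)+1)⁻¹ • x) (Pi.single m 1)| ≤ C := by
            have := (fderiv ℝ χ (((k:ℝ)+1)⁻¹ • x)).le_opNorm (Pi.single m 1)
            rw [Real.norm_eq_abs] at this
            refine this.trans ((mul_le_mul (hC _) hsn (norm_nonneg _) hC0).trans (by simp))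
          rw [abs_mul, abs_mul, abs_of_pos (inv_pos.2 hk)]
          calc _ ≤ ‖x‖ * (((k:ℝ)+1)⁻¹ * C) := by gcongr
            _ = (((k:ℝ)+1)⁻¹ * ‖x‖) * C := by ring
            _ ≤ 2 * C := by gcongr
        · have : fderiv ℝ χ (((k:ℝ)+1)⁻¹ • x) = 0 := by
            by_contra hne
            have h1 := (support_fderiv_subset ℝ (f := (χ : (Fin (n+1) → ℝ) → ℝ))) hne
            rw [χ.tsupport_eq] at h1
            exact hx (by simpa [χ] using h1)
          simp [this]; positivity
      · rw [abs_mul, abs_mul, abs_of_nonneg χ.nonneg]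
        calc _ ≤ (1:ℝ) * (1 * 1) := by
              gcongr
              · exact χ.le_one
              · exact hb _
          _ = 1 := by norm_num
    · refine Eventually.of_forall fun q => ?_
      have hinv : Tendsto (fun k : ℕ => ((k:ℝ)+1)⁻¹) atTop (nhds 0) := by
        simpa using tendsto_one_div_add_atTop_nhds_zero_nat (𝕜 := ℝ)
      set x := (fun i : Fin (n+1) => coords q (i:ℕ)) with hxd
      have hsm : Tendsto (fun k : ℕ => ((k:ℝ)+1)⁻¹ • x) atTop (nhds 0) := by
        simpa using hinv.smul_const x
      have h1 : Tendsto (fun k : ℕ => χ (((k:ℝ)+1)⁻¹ • x)) atTop (nhds 1) := by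
        have := (χ.continuous.tendsto 0).comp hsm
        rwa [χ.one_of_mem_closedBall (by simp [χ])] at this
      have h2 : ∀ m : Fin (n+1), Tendsto (fun k : ℕ => fderiv ℝ χ (((k:ℝ)+1)⁻¹ • x) (Pi.single m 1)) atTop
          (nhds (fderiv ℝ χ 0 (Pi.single m 1))) := fun m =>
        ((hcont.clm_apply continuous_const).tendsto 0).comp hsm
      have h3 : Tendsto (fun k => ∑ m : Fin (n+1), fderiv ℝ (G k) x (Pi.single m 1) * v m q) atTop
          (nhds (∑ m : Fin (n+1), (g (x l) * (0 * fderiv ℝ χ 0 (Pi.single m 1))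
            + 1 * (g' (x l) * (Pi.single m 1 : Fin (n+1) → ℝ) l)) * v m q)) := by
        refine tendsto_finsetSum _ fun m _ => ?_
        simp only [hGd]
        exact (((hinv.mul (h2 m)).const_mul _).add (h1.mul_const _)).mul_const _
      convert h3 using 2
      rw [Finset.sum_eq_single l]
      · simp [l, hxd]
      · intro m _ hm
        simp [hm.symm]
      · simp
  have : (fun k => ∫ q, (∑ m : Fin (n+1),
          fderiv ℝ (G k) (fun i : Fin (n+1) => coords q (i : ℕ)) (Pi.single m 1) * v m q) ∂π)
      = fun _ => 0 := funext key
  rw [this] at hlim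
  exact tendsto_nhds_unique hlim tendsto_const_nhds


lemma psi_deriv (x : ℝ) : HasDerivAt (fun x : ℝ => √(1 + x ^ 2)) (x / √(1 + x ^ 2)) x := by
  have h : (1 + x ^ 2) ≠ 0 := by positivity
  have h1 : HasDerivAt (fun x : ℝ => 1 + x ^ 2) (2 * x) x := by
    simpa using ((hasDerivAt_pow 2 x).const_add 1)
  convert h1.sqrt h using 1
  have : √(1 + x ^ 2) ≠ 0 := by positivity
  field_simp

lemma abs_psi_le (x : ℝ) : |x / √(1 + x ^ 2)| ≤ 1 := by
  rw [abs_div, abs_of_nonneg (Real.sqrt_nonneg _)]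
  refine div_le_one_of_le₀ ?_ (Real.sqrt_nonneg _)
  exact Real.abs_le_sqrt (by linarith)

lemma phi_convex (u v : ℝ) :
    u / √(1 + u ^ 2) * (v - u) ≤ √(1 + v ^ 2) - √(1 + u ^ 2) := by
  have hu : 0 < √(1 + u ^ 2) := by positivity
  have hv : 0 < √(1 + v ^ 2) := by positivity
  have hu2 : √(1 + u ^ 2) ^ 2 = 1 + u ^ 2 := Real.sq_sqrt (by positivity)
  have h : 1 + u * v ≤ √(1 + v ^ 2) * √(1 + u ^ 2) := by
    rw [← Real.sqrt_mul (by positivity)]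
    apply Real.le_sqrt_of_sq_le
    nlinarith [sq_nonneg (u - v)]
  rw [div_mul_eq_mul_div, div_le_iff₀ hu]
  nlinarith

lemma phi_strict (u v : ℝ) (h : u ≠ v) :
    u / √(1 + u ^ 2) * (v - u) < √(1 + v ^ 2) - √(1 + u ^ 2) := by
  have hu : 0 < √(1 + u ^ 2) := by positivity
  have hv : 0 < √(1 + v ^ 2) := by positivity
  have hu2 : √(1 + u ^ 2) ^ 2 = 1 + u ^ 2 := Real.sq_sqrt (by positivity)
  have h : 1 + u * v < √(1 + v ^ 2) * √(1 + u ^ 2) := by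
    rw [← Real.sqrt_mul (by positivity)]
    apply Real.lt_sqrt_of_sq_lt
    nlinarith [sq_pos_of_ne_zero (sub_ne_zero.2 h)]
  rw [div_mul_eq_mul_div, div_lt_iff₀ hu]
  nlinarith

lemma psi_mono (u v : ℝ) : 0 ≤ (u / √(1 + u ^ 2) - v / √(1 + v ^ 2)) * (u - v) := by
  have h1 := phi_convex u v
  have h2 := phi_convex v u
  nlinarith

lemma psi_strict (u v : ℝ) (h : (u / √(1 + u ^ 2) - v / √(1 + v ^ 2)) * (u - v) = 0) : u = v := by
  by_contra hne
  have h1 := phi_strict u v hne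
  have h2 := phi_convex v u
  nlinarith

/-- The fluxes vanish almost surely. -/
lemma flux_ae_zero
    (a b r : ℝ) (ha : 0 < a) (hb : 0 < b) (c : ℝ) (hc : 0 ≤ c)
    (π : Measure EllOne) [IsProbabilityMeasure π]
    (hpos : ∀ᵐ q ∂π, ∀ n : ℕ, 0 ≤ coords q n)
    (hmom : (∫⁻ q : EllOne, (‖q‖₊ : ENNReal) ∂π) ≠ ⊤)
    (H : ∀ (n : ℕ) (g g' : ℝ → ℝ), ContDiff ℝ 2 g → (∀ x, HasDerivAt g (g' x) x) →
      g 0 = 0 → (∀ x, |g' x| ≤ 1) →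
      ∫ q, g' (coords q n) *
        (fluxJprev a b r c (coords q) n - fluxJ a b r c (coords q) n) ∂π = 0)
    (n : ℕ) : ∀ᵐ q ∂π, fluxJ a b r c (coords q) n = 0 := by
  have hJi := integrable_flux a b r c π hmom
  have hPi := integrable_prev a b r c π hmom
  have hqi := integrable_coords π hmom
  -- mean fluxes vanish
  have hmean : ∀ n, ∫ q, fluxJ a b r c (coords q) n ∂π = 0 := by
    have h1 : ∀ n, ∫ q, fluxJ a b r c (coords q) n ∂π = ∫ q, fluxJprev a b r c (coords q) n ∂π := by
      intro n
      have := H n id (fun _ => 1) contDiff_id (fun x => hasDerivAt_id x) rfl (by simp)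
      simp only [one_mul] at this
      rw [integral_sub (hPi n) (hJi n)] at this
      linarith
    intro n
    induction n with
    | zero => rw [h1]; simp [fluxJprev]
    | succ n ih => rw [h1]; exact ih
  rcases hc.eq_or_lt with rfl | hc
  · have h1 : 0 ≤ᵐ[π] fun q => -fluxJ a b r 0 (coords q) n := by
      filter_upwards [hpos] with q hq
      have := hq (n+1)
      simp only [fluxJ, Pi.zero_apply]
      have h2 : 0 ≤ b * ((n:ℝ) + 3) ^ r * coords q (n+1) := by positivity
      linarith
    have h2 := (integral_eq_zero_iff_of_nonneg_ae h1 (hJi n).neg).1 (by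
      rw [integral_neg, hmean, neg_zero])
    filter_upwards [h2] with q hq
    simpa using hq
  -- the case c > 0
  set z : ℝ := a * c / b with hz
  have hz0 : 0 < z := by positivity
  let s : ℕ → ℝ := fun n => ((n:ℝ) + 2) ^ r / z ^ n
  have hs : ∀ n, 0 < s n := fun n => by simp only [s]; positivity
  let u : ℕ → EllOne → ℝ := fun n q => s n * coords q n
  let k : ℕ → ℝ := fun n => a * c * z ^ n
  have hk : ∀ n, 0 < k n := fun n => by simp only [k]; positivity
  have hJ : ∀ n q, fluxJ a b r c (coords q) n = k n * (u n q - u (n+1) q) := by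
    intro n q
    have hzn : z ^ n ≠ 0 := by positivity
    have hbz : b * z = a * c := by rw [hz]; field_simp
    simp only [fluxJ, k, u, s, pow_succ]
    push_cast
    rw [show (n:ℝ) + 1 + 2 = n + 3 by ring, ← hbz]
    field_simp
    linear_combination (-(n+2:ℝ)^r * coords q n) * hbz
  have hui : ∀ n, Integrable (u n) π := fun n => (hqi n).const_mul _
  have hu0 : ∀ᵐ q ∂π, ∀ n, 0 ≤ u n q := by
    filter_upwards [hpos] with q hq n
    exact mul_nonneg (hs n).le (hq n)
  have hum : ∀ n, ∫ q, u n q ∂π = ∫ q, u 0 q ∂π := by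
    intro n
    induction n with
    | zero => rfl
    | succ n ih =>
      have := hmean n
      simp only [hJ] at this
      rw [integral_const_mul, integral_sub (hui n) (hui (n+1))] at this
      have := (mul_eq_zero.1 this).resolve_left (hk n).ne'
      linarith
  set κ := ∫ q, u 0 q ∂π with hκ
  have hκ0 : 0 ≤ κ := integral_nonneg_of_ae (by filter_upwards [hu0] with q hq using hq 0)
  by_cases hz1 : 1 < z
  · -- supercritical: everything vanishes
    have hbd : ∀ n, κ ≤ s n * ∫ q, ‖q‖ ∂π := by
      intro n
      rw [← hum n, ← integral_const_mul]
      refine integral_mono (hui n) ((integrable_norm π hmom).const_mul _) fun q => ?_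
      exact mul_le_mul_of_nonneg_left ((le_abs_self _).trans (abs_coords_le q n)) (hs n).le
    have hs0 : Tendsto s atTop (nhds 0) := by
      have h1 := tendsto_rpow_mul_exp_neg_mul_atTop_nhds_zero r (Real.log z) (Real.log_pos hz1)
      have h2 : Tendsto (fun n : ℕ => (n:ℝ) + 2) atTop atTop :=
        tendsto_atTop_add_const_right _ _ tendsto_natCast_atTop_atTop
      have h3 := (h1.comp h2).mul_const (z ^ 2)
      rw [zero_mul] at h3
      refine h3.congr fun n => ?_
      simp only [Function.comp, s]
      have : Real.exp (-Real.log z * ((n:ℝ)+2)) = (z ^ (n+2))⁻¹ := by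
        rw [neg_mul, Real.exp_neg, ← Real.rpow_def_of_pos hz0]
        norm_cast
      rw [this, pow_add]
      field_simp
    have hκz : κ = 0 := by
      refine le_antisymm ?_ hκ0
      have := hs0.mul_const (∫ q : EllOne, ‖q‖ ∂π)
      rw [zero_mul] at this
      exact ge_of_tendsto' this hbd
    have huz : ∀ n, ∀ᵐ q ∂π, u n q = 0 := fun n =>
      (integral_eq_zero_iff_of_nonneg_ae (by filter_upwards [hu0] with q hq using hq n) (hui n)).1
        (by rw [hum, hκz])
    filter_upwards [huz n, huz (n+1)] with q h1 h2
    rw [hJ, h1, h2]; simp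
  · push Not at hz1
    let ψ : ℝ → ℝ := fun x => x / √(1 + x ^ 2)
    have hψc : Continuous ψ := by
      refine continuous_id.div (by fun_prop) fun x => ?_
      positivity
    have hψb : ∀ x, |ψ x| ≤ 1 := abs_psi_le
    have hum' : ∀ n, AEStronglyMeasurable (u n) π := fun n => (hui n).aestronglyMeasurable
    have hmul : ∀ n (f : EllOne → ℝ), Integrable f π → Integrable (fun q => ψ (u n q) * f q) π := by
      intro n f hf
      refine hf.bdd_mul (c := 1) (hψc.comp_aestronglyMeasurable (hum' n)) ?_
      exact Eventually.of_forall fun q => by simpa using hψb _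
    let Φ : ℕ → ℝ := fun n => - ∫ q, ψ (u n q) * fluxJ a b r c (coords q) n ∂π
    have hbal : ∀ n, ∫ q, ψ (u n q) * fluxJ a b r c (coords q) n ∂π =
        ∫ q, ψ (u n q) * fluxJprev a b r c (coords q) n ∂π := by
      intro n
      have hd : ∀ x, HasDerivAt (fun x => (√(1 + (s n * x) ^ 2) - 1) / s n) (ψ (s n * x)) x := by
        intro x
        have h1 := ((psi_deriv (s n * x)).comp x ((hasDerivAt_id x).const_mul (s n)))
        have h2 := (h1.sub_const 1).div_const (s n)
        have h3 : s n * x / √(1 + (s n * x) ^ 2) * (s n * 1) / s n = ψ (s n * x) := by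
          rw [mul_one, mul_div_cancel_right₀ _ (hs n).ne']
        rw [h3] at h2
        exact h2
      have := H n (fun x => (√(1 + (s n * x) ^ 2) - 1) / s n) (fun x => ψ (s n * x)) ?_ hd (by simp)
        (fun x => hψb _)
      · simp only [mul_sub] at this
        rw [integral_sub (hmul n _ (hPi n)) (hmul n _ (hJi n))] at this
        linarith
      · refine ContDiff.div_const (ContDiff.sub (ContDiff.sqrt (by fun_prop) fun x => ?_)
          contDiff_const) _
        positivity
    let D : ℕ → EllOne → ℝ := fun n q =>
      (ψ (u n q) - ψ (u (n+1) q)) * fluxJ a b r c (coords q) n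
    have hDi : ∀ n, Integrable (D n) π := by
      intro n
      simp only [D, sub_mul]
      exact (hmul n _ (hJi n)).sub (hmul (n+1) _ (hJi n))
    have hD0 : ∀ n q, 0 ≤ D n q := by
      intro n q
      simp only [D, hJ]
      have := mul_nonneg (hk n).le (psi_mono (u n q) (u (n+1) q))
      simp only [ψ]
      linarith
    have hΦ0 : Φ 0 = 0 := by
      simp only [Φ, hbal]; simp [fluxJprev]
    have hΦs : ∀ n, Φ (n+1) = Φ n + ∫ q, D n q ∂π := by
      intro n
      have h1 : ∫ q, D n q ∂π = ∫ q, ψ (u n q) * fluxJ a b r c (coords q) n ∂π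
          - ∫ q, ψ (u (n+1) q) * fluxJ a b r c (coords q) n ∂π := by
        rw [← integral_sub (hmul n _ (hJi n)) (hmul (n+1) _ (hJi n))]
        simp only [D, sub_mul]
      have h2 := hbal (n+1)
      simp only [fluxJprev] at h2
      simp only [Φ, h1, h2]
      ring
    have hΦm : Monotone Φ := monotone_nat_of_le_succ fun n => by
      rw [hΦs]; linarith [(integral_nonneg (hD0 n) : 0 ≤ ∫ q, D n q ∂π)]
    let E : ℕ → ℝ := fun n => ∫ q, √(1 + u n q ^ 2) ∂π
    have hφle : ∀ x : ℝ, √(1 + x ^ 2) ≤ 1 + |x| := by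
      intro x
      rw [Real.sqrt_le_left (by positivity)]
      nlinarith [sq_abs x, abs_nonneg x]
    have hφi : ∀ n, Integrable (fun q => √(1 + u n q ^ 2)) π := by
      intro n
      refine ((integrable_const (1:ℝ)).add (hui n).abs).mono' ?_ ?_
      · exact (by fun_prop : Continuous fun x : ℝ => √(1 + x ^ 2)).comp_aestronglyMeasurable (hum' n)
      · refine Eventually.of_forall fun q => ?_
        rw [Real.norm_eq_abs, abs_of_nonneg (Real.sqrt_nonneg _)]
        exact hφle _
    have hEle : ∀ n, E n ≤ 1 + κ := by
      intro n
      calc E n ≤ ∫ q, (1 + u n q) ∂π := by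
            refine integral_mono_ae (hφi n) ((integrable_const (1:ℝ)).add (hui n)) ?_
            filter_upwards [hu0] with q hq
            have := hφle (u n q)
            rwa [abs_of_nonneg (hq n)] at this
        _ = 1 + κ := by
            rw [integral_add (integrable_const (1:ℝ)) (hui n), hum]; simp
    have hEs : ∀ n, Φ n ≤ k n * (E (n+1) - E n) := by
      intro n
      simp only [Φ, E]
      rw [← integral_neg, ← integral_sub (hφi (n+1)) (hφi n), ← integral_const_mul]
      refine integral_mono (hmul n _ (hJi n)).neg (((hφi (n+1)).sub (hφi n)).const_mul _) fun q => ?_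
      have := mul_le_mul_of_nonneg_left (phi_convex (u n q) (u (n+1) q)) (hk n).le
      simp only [hJ, ψ]
      linarith
    have hkle : ∀ n, k n ≤ a * c := fun n =>
      mul_le_of_le_one_right (by positivity) (pow_le_one₀ hz0.le hz1)
    have hΦle : ∀ m, Φ m ≤ 0 := by
      intro m
      by_contra! hm
      have hac : 0 < a * c := by positivity
      have hstep : ∀ j, Φ m / (a * c) ≤ E (m + j + 1) - E (m + j) := by
        intro j
        have h1 : Φ m ≤ k (m+j) * (E (m+j+1) - E (m+j)) := (hΦm (by omega)).trans (hEs (m+j))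
        have h2 : 0 < E (m+j+1) - E (m+j) := by
          by_contra! h
          nlinarith [hk (m+j)]
        rw [div_le_iff₀ hac]
        nlinarith [hkle (m+j)]
      have hlin : ∀ j : ℕ, E m + j * (Φ m / (a * c)) ≤ E (m + j) := by
        intro j
        induction j with
        | zero => simp
        | succ j ih =>
          have := hstep j
          rw [← add_assoc]; push_cast
          linarith
      obtain ⟨j, hj⟩ := exists_nat_gt ((1 + κ - E m) / (Φ m / (a * c)))
      rw [div_lt_iff₀ (by positivity)] at hj
      linarith [hlin j, hEle (m+j)]
    have hΦz : ∀ m, Φ m = 0 := fun m =>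
      le_antisymm (hΦle m) (hΦ0 ▸ hΦm (Nat.zero_le m))
    have hDz : ∫ q, D n q ∂π = 0 := by
      have := hΦs n
      rw [hΦz, hΦz] at this
      linarith
    have hae := (integral_eq_zero_iff_of_nonneg (hD0 n) (hDi n)).1 hDz
    filter_upwards [hae] with q hq
    simp only [D, hJ, Pi.zero_apply, ψ] at hq
    have h1 : k n * ((u n q / √(1 + u n q ^ 2) - u (n+1) q / √(1 + u (n+1) q ^ 2)) *
        (u n q - u (n+1) q)) = 0 := by linarith
    have h2 := psi_strict _ _ ((mul_eq_zero.1 h1).resolve_left (hk n).ne')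
    rw [hJ, h2]; simp

end BD

theorem stationary_measure_annihilates_fluxes
    (abar bbar r : ℝ) (habar : 0 < abar) (hbbar : 0 < bbar) (hr : 0 ≤ r)
    (c : ℝ) (hc : 0 ≤ c)
    (π : Measure EllOne) [IsProbabilityMeasure π]
    (hπpos : π {q : EllOne | ∀ n : ℕ, 0 ≤ coords q n} = 1)
    (hπmom : (∫⁻ q : EllOne, (‖q‖₊ : ENNReal) ∂π) ≠ ⊤)
    (hstat : ∀ N : ℕ, 1 ≤ N → ∀ G : (Fin N → ℝ) → ℝ,
      ContDiff ℝ 2 G → G 0 = 0 →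
      (∀ n : Fin N,
        ContDiff ℝ 1 (fun x : Fin N → ℝ => fderiv ℝ G x (Pi.single n 1)) ∧
        HasCompactSupport (fun x : Fin N → ℝ => fderiv ℝ G x (Pi.single n 1))) →
      ∫ q, (∑ n : Fin N,
          fderiv ℝ G (fun i : Fin N => coords q (i : ℕ)) (Pi.single n 1) *
            (fluxJprev abar bbar r c (coords q) (n : ℕ) -
              fluxJ abar bbar r c (coords q) (n : ℕ))) ∂π = 0) :
    ∀ n : ℕ, ∀ M : ℕ, 1 ≤ M → ∀ F : (Fin M → ℝ) → ℝ,
      ContDiff ℝ 1 F → HasCompactSupport F →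
      ∫ q, F (fun i : Fin M => coords q (i : ℕ)) *
        fluxJ abar bbar r c (coords q) n ∂π = 0 := by
  have hposae : ∀ᵐ q ∂π, ∀ n : ℕ, 0 ≤ coords q n := by
    have hm : MeasurableSet {q : EllOne | ∀ n : ℕ, 0 ≤ coords q n} := by
      rw [Set.ofPred_forall]
      exact MeasurableSet.iInter fun n =>
        (isClosed_le continuous_const (BD.continuous_coords n)).measurableSet
    exact (prob_compl_eq_zero_iff hm).2 hπpos
  intro n M _ F _ _
  have h := BD.flux_ae_zero abar bbar r habar hbbar c hc π hposae hπmom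
    (fun n g g' h1 h2 h3 h4 => BD.one_var abar bbar r c π hπmom hstat n g g' h1 h2 h3 h4) n
  rw [integral_congr_ae (g := fun _ => (0 : ℝ)), integral_zero]
  filter_upwards [h] with q hq
  rw [hq, mul_zero]
end

section
/- Let X be the set of finite Borel measures ν on [0,∞) with finite first moment ∫_{[0,∞)} x dν(x) < ∞, and for ν ∈ X let Id·ν denote the finite Borel measure with density x with respect to ν (ν.withDensity of the identity). Define d(ν, μ) = LP(ν, μ) + LP(Id·ν, Id·μ), where LP denotes the Lévy–Prokhorov distance on finite Borel measures on [0,∞). Then d is a metric on X and (X, d) is a complete separable metric space. -/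
open MeasureTheory NNReal

/-- The set of finite Borel measures on `[0,∞)` with finite first moment,
realized as a subtype. -/
def FirstMomentMeasures : Type :=
  {ν : Measure ℝ≥0 // IsFiniteMeasure ν ∧ (∫⁻ x, (x : ENNReal) ∂ν) < ⊤}

/-- The distance `d(ν,μ) = LP(ν,μ) + LP(Id·ν, Id·μ)`, where `LP` is the
Lévy–Prokhorov distance and `Id·ν` is the measure with density `x` with
respect to `ν`. -/
noncomputable def LPmomentDist (p q : FirstMomentMeasures) : ℝ :=
  levyProkhorovDist p.1 q.1 +
    levyProkhorovDist (p.1.withDensity fun x : ℝ≥0 => (x : ENNReal))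
      (q.1.withDensity fun x : ℝ≥0 => (x : ENNReal))


open Metric Filter Topology

lemma fmm_measure_le_of_bounded (μ : Measure ℝ≥0) (B : Set ℝ≥0) (X : ENNReal)
    (h : ∀ R : ℕ, μ (B ∩ Set.Iic (R : ℝ≥0)) ≤ X) : μ B ≤ X := by
  have hmono : Monotone (fun R : ℕ => B ∩ Set.Iic (R : ℝ≥0)) := by
    intro a b hab
    exact Set.inter_subset_inter_right _ (Set.Iic_subset_Iic.2 (by exact_mod_cast hab))
  have hU : (⋃ R : ℕ, B ∩ Set.Iic (R : ℝ≥0)) = B := by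
    rw [← Set.inter_iUnion]
    apply Set.inter_eq_left.2
    intro x _
    obtain ⟨n, hn⟩ := exists_nat_ge x
    exact Set.mem_iUnion.2 ⟨n, hn⟩
  rw [← hU, hmono.measure_iUnion]
  exact iSup_le h

lemma fmm_lintegral_thickenedIndicator_le (μ : Measure ℝ≥0) (E : Set ℝ≥0) {δ : ℝ} (hδ : 0 < δ) :
    ∫⁻ x, (thickenedIndicator hδ E x : ENNReal) ∂μ ≤ μ (thickening δ E) := by
  rw [← lintegral_indicator_one isOpen_thickening.measurableSet]
  apply lintegral_mono
  intro x
  by_cases hx : x ∈ thickening δ E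
  · simp only [hx, Set.indicator_of_mem, Pi.one_apply]
    exact_mod_cast thickenedIndicator_le_one hδ E x
  · simp [thickenedIndicator_zero hδ E hx]

/-- Lower semicontinuity of the LP distance under vague convergence. -/
lemma fmm_lsc {ι : Type*} (U : Filter ι) [NeBot U] (μs : ι → Measure ℝ≥0) (μ ν : Measure ℝ≥0)
    (c : ENNReal) (hctop : c ≠ ⊤)
    (hconv : ∀ (E : Set ℝ≥0) (R : ℝ≥0), E ⊆ Set.Iic R → ∀ (δ : ℝ) (hδ : 0 < δ),
      Tendsto (fun i => ∫⁻ x, (thickenedIndicator hδ E x : ENNReal) ∂(μs i)) U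
        (𝓝 (∫⁻ x, (thickenedIndicator hδ E x : ENNReal) ∂μ)))
    (hc : ∀ᶠ i in U, levyProkhorovEDist (μs i) ν < c) :
    levyProkhorovEDist μ ν ≤ c := by
  apply levyProkhorovEDist_le_of_forall_add_pos_le
  intro ε B hε hεtop hB
  have hδ : 0 < ε.toReal := ENNReal.toReal_pos hε.ne' hεtop.ne
  have hsum : (c + ε).toReal = c.toReal + ε.toReal := ENNReal.toReal_add hctop hεtop.ne
  have hsub1 : ∀ R : ℝ≥0, thickening c.toReal (thickening ε.toReal (B ∩ Set.Iic R)) ⊆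
      thickening (c + ε).toReal B := by
    intro R
    rw [hsum]
    exact (thickening_thickening_subset _ _ _).trans
      (thickening_subset_of_subset _ Set.inter_subset_left)
  have hsub2 : ∀ R : ℝ≥0, thickening ε.toReal (thickening c.toReal (B ∩ Set.Iic R)) ⊆
      thickening (c + ε).toReal B := by
    intro R
    rw [hsum, add_comm]
    exact (thickening_thickening_subset _ _ _).trans
      (thickening_subset_of_subset _ Set.inter_subset_left)
  constructor
  · apply fmm_measure_le_of_bounded
    intro R
    refine le_trans ?_ (le_self_add : _ ≤ _ + ε)
    refine (measure_le_lintegral_thickenedIndicator μ (hB.inter measurableSet_Iic) hδ).trans ?_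
    refine le_of_tendsto (hconv _ (R : ℝ≥0) Set.inter_subset_right _ hδ) ?_
    filter_upwards [hc] with i hi
    refine (fmm_lintegral_thickenedIndicator_le _ _ hδ).trans ?_
    refine (left_measure_le_of_levyProkhorovEDist_lt hi isOpen_thickening.measurableSet).trans ?_
    gcongr
    exact hsub1 R
  · apply fmm_measure_le_of_bounded
    intro R
    refine le_trans ?_ (le_self_add : _ ≤ _ + ε)
    have hbd : thickening c.toReal (B ∩ Set.Iic (R : ℝ≥0)) ⊆ Set.Iic (R + c.toNNReal) := by
      intro x hx
      obtain ⟨z, hz, hxz⟩ := mem_thickening_iff.1 hx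
      have h1 : (z : ℝ) ≤ R := by exact_mod_cast hz.2
      rw [NNReal.dist_eq] at hxz
      have h2 := (abs_lt.1 hxz).2
      have : (x : ℝ) ≤ R + c.toReal := by linarith
      exact_mod_cast this
    have hT := (hconv _ _ hbd _ hδ).add_const c
    have : μ (thickening ε.toReal (thickening c.toReal (B ∩ Set.Iic (R : ℝ≥0)))) + c ≤
        μ (thickening (c + ε).toReal B) + c := by
      gcongr
      exact hsub2 R
    refine le_trans ?_ this
    refine le_trans ?_ (add_le_add_left (fmm_lintegral_thickenedIndicator_le _ _ hδ) c)
    refine ge_of_tendsto hT ?_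
    filter_upwards [hc] with i hi
    refine (right_measure_le_of_levyProkhorovEDist_lt hi (hB.inter measurableSet_Iic)).trans ?_
    gcongr
    exact measure_le_lintegral_thickenedIndicator _ isOpen_thickening.measurableSet hδ

/-- Vague convergence of the measures with density `x`. -/
lemma fmm_conv_withDensity {ι : Type*} (U : Filter ι) (μs : ι → FiniteMeasure ℝ≥0)
    (μ : FiniteMeasure ℝ≥0) (h : Tendsto μs U (𝓝 μ)) (E : Set ℝ≥0) (R : ℝ≥0)
    (hE : E ⊆ Set.Iic R) (δ : ℝ) (hδ : 0 < δ) :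
    Tendsto (fun i => ∫⁻ x, (thickenedIndicator hδ E x : ENNReal)
        ∂((μs i : Measure ℝ≥0).withDensity fun x : ℝ≥0 => (x : ENNReal))) U
        (𝓝 (∫⁻ x, (thickenedIndicator hδ E x : ENNReal)
          ∂((μ : Measure ℝ≥0).withDensity fun x : ℝ≥0 => (x : ENNReal)))) := by
  have key : ∀ m : Measure ℝ≥0, ∫⁻ x, (thickenedIndicator hδ E x : ENNReal)
      ∂(m.withDensity fun x : ℝ≥0 => (x : ENNReal)) =
      ∫⁻ x, ((x * thickenedIndicator hδ E x : ℝ≥0) : ENNReal) ∂m := by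
    intro m
    rw [lintegral_withDensity_eq_lintegral_mul _ (by fun_prop)
      (by have := (thickenedIndicator hδ E).continuous; fun_prop)]
    simp
  have hb : ∀ x : ℝ≥0, x * thickenedIndicator hδ E x ≤ R + δ.toNNReal := by
    intro x
    by_cases hx : x ∈ thickening δ E
    · obtain ⟨z, hz, hxz⟩ := mem_thickening_iff.1 hx
      have h1 : (z : ℝ) ≤ R := by exact_mod_cast hE hz
      rw [NNReal.dist_eq] at hxz
      have h2 := (abs_lt.1 hxz).2
      have h3 : x ≤ R + δ.toNNReal := by
        rw [← NNReal.coe_le_coe]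
        push_cast
        rw [Real.coe_toNNReal _ hδ.le]
        linarith
      exact (mul_le_of_le_one_right' (thickenedIndicator_le_one hδ E x)).trans h3
    · simp [thickenedIndicator_zero hδ E hx]
  let g : BoundedContinuousFunction ℝ≥0 ℝ≥0 := BoundedContinuousFunction.mkOfBound
    ⟨fun x => x * thickenedIndicator hδ E x,
      continuous_id.mul (thickenedIndicator hδ E).continuous⟩ (R + δ.toNNReal : ℝ≥0) (by
      intro x y
      have hx : ((x * thickenedIndicator hδ E x : ℝ≥0) : ℝ) ≤ (R + δ.toNNReal : ℝ≥0) := by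
        exact_mod_cast hb x
      have hy : ((y * thickenedIndicator hδ E y : ℝ≥0) : ℝ) ≤ (R + δ.toNNReal : ℝ≥0) := by
        exact_mod_cast hb y
      have hx0 := (x * thickenedIndicator hδ E x : ℝ≥0).coe_nonneg
      have hy0 := (y * thickenedIndicator hδ E y : ℝ≥0).coe_nonneg
      change dist (x * thickenedIndicator hδ E x : ℝ≥0) (y * thickenedIndicator hδ E y) ≤ _
      rw [NNReal.dist_eq, abs_le]
      constructor <;> linarith)
  simp only [key]
  exact FiniteMeasure.tendsto_iff_forall_lintegral_tendsto.1 h g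

/-- Two finite measures at LP distance zero are equal. -/
lemma fmm_eq_of_edist_zero (μ ν : Measure ℝ≥0) [IsFiniteMeasure μ] [IsFiniteMeasure ν]
    (h : levyProkhorovEDist μ ν = 0) : μ = ν := by
  have hcl : ∀ A : Set ℝ≥0, IsClosed A → μ A = ν A := fun A hA =>
    measure_eq_measure_of_levyProkhorovEDist_eq_zero_of_isClosed h hA
      ⟨1, one_pos, measure_ne_top _ _⟩ ⟨1, one_pos, measure_ne_top _ _⟩
  refine ext_of_generate_finite _ ?_ isPiSystem_isClosed (fun A hA ↦ hcl A hA)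
    (hcl _ isClosed_univ)
  rw [BorelSpace.measurable_eq (α := ℝ≥0), borel_eq_generateFrom_isClosed]

/-- A one-sided discretization estimate. -/
lemma fmm_discr_aux (μ ν : Measure ℝ≥0) (h : ℝ≥0) (hh : 0 < h) (N : ℕ)
    (η t : ENNReal) (htail : μ {x | N ≤ ⌊x / h⌋₊} ≤ t)
    (hcell : ∀ k < N, μ {x | ⌊x / h⌋₊ = k} ≤ ν {x | ⌊x / h⌋₊ = k} + η)
    (B : Set ℝ≥0) : μ B ≤ ν (thickening h B) + (N * η + t) := by
  classical
  have hfm : Measurable (fun x : ℝ≥0 => ⌊x / h⌋₊) := Nat.measurable_floor.comp (by fun_prop)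
  let J := (Finset.range N).filter (fun k => ∃ x ∈ B, ⌊x / h⌋₊ = k)
  have hsub : B ⊆ (⋃ k ∈ J, {x | ⌊x / h⌋₊ = k}) ∪ {x | N ≤ ⌊x / h⌋₊} := by
    intro x hx
    by_cases hN : N ≤ ⌊x / h⌋₊
    · exact Or.inr hN
    · left
      simp only [Set.mem_iUnion]
      exact ⟨⌊x / h⌋₊, Finset.mem_filter.2 ⟨Finset.mem_range.2 (not_le.1 hN), x, hx, rfl⟩, rfl⟩
  have hthick : (⋃ k ∈ J, {x | ⌊x / h⌋₊ = k}) ⊆ thickening h B := by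
    intro x hx
    simp only [Set.mem_iUnion] at hx
    obtain ⟨k, hk, hxk⟩ := hx
    obtain ⟨_, y, hy, hyk⟩ := Finset.mem_filter.1 hk
    have hxk' : ⌊x / h⌋₊ = k := hxk
    refine mem_thickening_iff.2 ⟨y, hy, ?_⟩
    have hh' : (0 : ℝ) < h := hh
    have a1 : (k : ℝ) ≤ x / h := by
      have := Nat.floor_le (a := x / h) zero_le; rw [hxk'] at this; exact_mod_cast this
    have a2 : (x / h : ℝ) < k + 1 := by
      have := Nat.lt_floor_add_one (x / h); rw [hxk'] at this; exact_mod_cast this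
    have b1 : (k : ℝ) ≤ y / h := by
      have := Nat.floor_le (a := y / h) zero_le; rw [hyk] at this; exact_mod_cast this
    have b2 : (y / h : ℝ) < k + 1 := by
      have := Nat.lt_floor_add_one (y / h); rw [hyk] at this; exact_mod_cast this
    rw [le_div_iff₀ hh'] at a1 b1
    rw [div_lt_iff₀ hh'] at a2 b2
    rw [NNReal.dist_eq, abs_lt]
    constructor <;> linarith
  calc μ B ≤ μ (⋃ k ∈ J, {x | ⌊x / h⌋₊ = k}) + μ {x | N ≤ ⌊x / h⌋₊} :=
        (measure_mono hsub).trans (measure_union_le _ _)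
    _ ≤ (∑ k ∈ J, μ {x | ⌊x / h⌋₊ = k}) + t := by
        gcongr
        exact measure_biUnion_finset_le _ _
    _ ≤ (∑ k ∈ J, (ν {x | ⌊x / h⌋₊ = k} + η)) + t := by
        gcongr with k hk
        exact hcell k (Finset.mem_range.1 (Finset.mem_filter.1 hk).1)
    _ = ν (⋃ k ∈ J, {x | ⌊x / h⌋₊ = k}) + J.card * η + t := by
        rw [Finset.sum_add_distrib, Finset.sum_const, nsmul_eq_mul, measure_biUnion_finset]
        · intro i _ j _ hij
          exact Set.disjoint_left.2 fun x hi hj => hij (Eq.trans (Eq.symm hi) hj)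
        · intro k _
          exact hfm (measurableSet_singleton k)
    _ ≤ ν (thickening h B) + (N * η + t) := by
        rw [add_assoc]
        gcongr
        exact (Finset.card_filter_le _ _).trans (by simp)

lemma fmm_tail (μ : Measure ℝ≥0) [IsFiniteMeasure μ] (h : ℝ≥0) (t : ENNReal) (ht : 0 < t) :
    ∃ N : ℕ, μ {x | N ≤ ⌊x / h⌋₊} ≤ t := by
  have hfm : Measurable (fun x : ℝ≥0 => ⌊x / h⌋₊) := Nat.measurable_floor.comp (by fun_prop)
  have hT : Tendsto (fun N : ℕ => μ {x | N ≤ ⌊x / h⌋₊}) atTop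
      (𝓝 (μ (⋂ N : ℕ, {x | N ≤ ⌊x / h⌋₊}))) := by
    apply tendsto_measure_iInter_atTop
    · exact fun N => (hfm measurableSet_Ici).nullMeasurableSet
    · intro a b hab x hx
      exact le_trans hab hx
    · exact ⟨0, measure_ne_top _ _⟩
  have he : (⋂ N : ℕ, {x : ℝ≥0 | N ≤ ⌊x / h⌋₊}) = ∅ := by
    apply Set.eq_empty_of_forall_notMem
    intro x hx
    have := Set.mem_iInter.1 hx (⌊x / h⌋₊ + 1)
    simp at this
  rw [he, measure_empty] at hT
  obtain ⟨N, hN⟩ := (hT.eventually (gt_mem_nhds ht)).exists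
  exact ⟨N, hN.le⟩

/-- A countable discretization of finite measures for the LP distance. -/
lemma fmm_discr (ε : ℝ≥0) (hε : 0 < ε) : ∃ G : FiniteMeasure ℝ≥0 → List ℕ,
    ∀ μ ν : FiniteMeasure ℝ≥0, G μ = G ν →
      levyProkhorovEDist (μ : Measure ℝ≥0) (ν : Measure ℝ≥0) ≤ ε := by
  have h2 : (0 : ENNReal) < ((ε / 2 : ℝ≥0) : ENNReal) := by
    exact_mod_cast half_pos hε
  choose N hN using fun μ : FiniteMeasure ℝ≥0 => fmm_tail (μ : Measure ℝ≥0) ε _ h2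
  let η : ℕ → ℝ≥0 := fun n => ε / 2 / (n + 1)
  have hη : ∀ n, 0 < η n := fun n => by positivity
  refine ⟨fun μ => (List.range (N μ)).map
    (fun k => ⌊μ {x | ⌊x / ε⌋₊ = k} / η (N μ)⌋₊), fun μ ν hG => ?_⟩
  have hNN : N μ = N ν := by simpa using congrArg List.length hG
  simp only [← hNN] at hG
  rw [List.map_inj_left] at hG
  have hcell : ∀ (μ ν : FiniteMeasure ℝ≥0) (n k : ℕ),
      ⌊μ {x | ⌊x / ε⌋₊ = k} / η n⌋₊ = ⌊ν {x | ⌊x / ε⌋₊ = k} / η n⌋₊ →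
      (μ : Measure ℝ≥0) {x | ⌊x / ε⌋₊ = k} ≤ (ν : Measure ℝ≥0) {x | ⌊x / ε⌋₊ = k} + η n := by
    intro μ ν n k hk
    have a := Nat.lt_floor_add_one (μ {x | ⌊x / ε⌋₊ = k} / η n)
    have b := Nat.floor_le (a := ν {x | ⌊x / ε⌋₊ = k} / η n) zero_le
    rw [hk] at a
    have c : μ {x | ⌊x / ε⌋₊ = k} / η n < ν {x | ⌊x / ε⌋₊ = k} / η n + 1 :=
      a.trans_le (by gcongr)
    rw [div_lt_iff₀ (hη n), add_mul, div_mul_cancel₀ _ (hη n).ne', one_mul] at c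
    rw [← FiniteMeasure.ennreal_coeFn_eq_coeFn_toMeasure,
      ← FiniteMeasure.ennreal_coeFn_eq_coeFn_toMeasure]
    exact_mod_cast c.le
  have hfin : ((N μ : ENNReal) * (η (N μ) : ENNReal) + ((ε / 2 : ℝ≥0) : ENNReal)) ≤ ε := by
    have : (N μ : ℝ≥0) * η (N μ) + ε / 2 ≤ ε := by
      have h3 : (N μ : ℝ≥0) * η (N μ) ≤ ε / 2 := by
        have : (N μ : ℝ≥0) * η (N μ) ≤ ((N μ : ℝ≥0) + 1) * η (N μ) := by
          gcongr; exact le_self_add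
        refine this.trans (le_of_eq ?_)
        simp only [η]
        field_simp
      calc _ ≤ ε / 2 + ε / 2 := by gcongr
        _ = ε := add_halves ε
    exact_mod_cast this
  refine sInf_le fun B _ => ⟨?_, ?_⟩
  · refine (fmm_discr_aux (μ : Measure ℝ≥0) ν ε hε (N μ) (η (N μ)) _ (hN μ)
      (fun k hk => hcell μ ν _ k (hG k (List.mem_range.2 hk))) B).trans ?_
    rw [ENNReal.coe_toReal]
    gcongr
  · refine (fmm_discr_aux (ν : Measure ℝ≥0) μ ε hε (N μ) (η (N μ)) _ (hNN ▸ hN ν)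
      (fun k hk => hcell ν μ _ k (hG k (List.mem_range.2 hk)).symm) B).trans ?_
    rw [ENNReal.coe_toReal]
    gcongr

/-- The measure with density `x`. -/
noncomputable def fmmM1 (p : FirstMomentMeasures) : Measure ℝ≥0 :=
  p.1.withDensity fun x : ℝ≥0 => (x : ENNReal)

instance fmm_fin0 (p : FirstMomentMeasures) : IsFiniteMeasure p.1 := p.2.1

lemma fmmM1_univ (p : FirstMomentMeasures) : fmmM1 p Set.univ = ∫⁻ x, (x : ENNReal) ∂p.1 := by
  simp [fmmM1]

instance fmm_fin1 (p : FirstMomentMeasures) : IsFiniteMeasure (fmmM1 p) :=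
  ⟨by rw [fmmM1_univ]; exact p.2.2⟩

lemma fmm_dist_def (p q : FirstMomentMeasures) :
    LPmomentDist p q = levyProkhorovDist p.1 q.1 + levyProkhorovDist (fmmM1 p) (fmmM1 q) := rfl

lemma fmm_LP_nonneg (μ ν : Measure ℝ≥0) : 0 ≤ levyProkhorovDist μ ν := ENNReal.toReal_nonneg

/-- The metric. -/
noncomputable abbrev fmmMetric : MetricSpace FirstMomentMeasures where
  dist := LPmomentDist
  dist_self p := by simp [fmm_dist_def, levyProkhorovDist_self]
  dist_comm p q := by
    rw [fmm_dist_def, fmm_dist_def, levyProkhorovDist_comm p.1, levyProkhorovDist_comm (fmmM1 p)]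
  dist_triangle p q r := by
    have h1 := levyProkhorovDist_triangle p.1 q.1 r.1
    have h2 := levyProkhorovDist_triangle (fmmM1 p) (fmmM1 q) (fmmM1 r)
    simp only [fmm_dist_def]
    linarith
  eq_of_dist_eq_zero := by
    intro p q h
    have h : LPmomentDist p q = 0 := h
    rw [fmm_dist_def] at h
    have h1 := fmm_LP_nonneg p.1 q.1
    have h2 := fmm_LP_nonneg (fmmM1 p) (fmmM1 q)
    have h3 : levyProkhorovDist p.1 q.1 = 0 := by linarith
    rw [levyProkhorovDist, ENNReal.toReal_eq_zero_iff] at h3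
    exact Subtype.ext (fmm_eq_of_edist_zero _ _ (h3.resolve_right (levyProkhorovEDist_ne_top _ _)))

lemma fmm_edist_lt (μ ν : Measure ℝ≥0) [IsFiniteMeasure μ] [IsFiniteMeasure ν] {r : ℝ}
    (h : levyProkhorovDist μ ν < r) : levyProkhorovEDist μ ν < ENNReal.ofReal r :=
  (ENNReal.lt_ofReal_iff_toReal_lt (levyProkhorovEDist_ne_top _ _)).2 h

lemma fmm_univ_le (μ ν : Measure ℝ≥0) {c : ENNReal} (h : levyProkhorovEDist μ ν < c) :
    μ Set.univ ≤ ν Set.univ + c :=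
  (left_measure_le_of_levyProkhorovEDist_lt h MeasurableSet.univ).trans
    (by gcongr; exact Set.subset_univ _)

lemma fmm_u_lim (C : ℝ≥0) :
    Tendsto (fun n : ℕ => C / ((n : ℝ≥0) + 1)) atTop (𝓝 0) := by
  rw [← NNReal.tendsto_coe]
  push_cast
  exact tendsto_const_nhds.div_atTop
    (tendsto_atTop_add_const_right _ _ tendsto_natCast_atTop_atTop)

set_option maxHeartbeats 2000000 in
lemma fmm_complete : @CompleteSpace FirstMomentMeasures fmmMetric.toUniformSpace := by
  let _ := fmmMetric
  apply Metric.complete_of_cauchySeq_tendsto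
  intro u hu
  have split : ∀ {p q : FirstMomentMeasures} {r : ℝ}, dist p q < r →
      levyProkhorovEDist p.1 q.1 < ENNReal.ofReal r ∧
      levyProkhorovEDist (fmmM1 p) (fmmM1 q) < ENNReal.ofReal r := by
    intro p q r h
    have h : LPmomentDist p q < r := h
    rw [fmm_dist_def] at h
    have h1 := fmm_LP_nonneg p.1 q.1
    have h2 := fmm_LP_nonneg (fmmM1 p) (fmmM1 q)
    exact ⟨fmm_edist_lt _ _ (by linarith), fmm_edist_lt _ _ (by linarith)⟩
  obtain ⟨R, hR, hbd⟩ := cauchySeq_bdd hu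
  obtain ⟨C, hC0, hC1⟩ : ∃ C : ℝ≥0, (∀ n, (u n).1 Set.univ ≤ C) ∧
      ∀ n, fmmM1 (u n) Set.univ ≤ C := by
    have hne : (u 0).1 Set.univ + fmmM1 (u 0) Set.univ + ENNReal.ofReal R ≠ ⊤ := by finiteness
    refine ⟨((u 0).1 Set.univ + fmmM1 (u 0) Set.univ + ENNReal.ofReal R).toNNReal, ?_, ?_⟩
    · intro n
      rw [ENNReal.coe_toNNReal hne]
      refine (fmm_univ_le _ _ (split (hbd n 0)).1).trans ?_
      gcongr
      exact le_self_add
    · intro n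
      rw [ENNReal.coe_toNNReal hne]
      refine (fmm_univ_le _ _ (split (hbd n 0)).2).trans ?_
      gcongr
      exact le_add_self
  let v : ℕ → FiniteMeasure ℝ≥0 := fun n => ⟨(u n).1, fmm_fin0 (u n)⟩
  have hcpt := isCompact_setOfPred_finiteMeasure_mass_le_compl_isCompact_le
    (u := fun n : ℕ => C / ((n : ℝ≥0) + 1)) (K := fun n : ℕ => Set.Icc (0 : ℝ≥0) ((n : ℝ≥0) + 1)) C
    (fmm_u_lim C)
    (fun n => isCompact_Icc) (Or.inl inferInstance)
  have hmem : ∀ n, v n ∈ {μ : FiniteMeasure ℝ≥0 | μ.mass ≤ C ∧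
      ∀ n : ℕ, μ (Set.Icc (0 : ℝ≥0) ((n : ℝ≥0) + 1))ᶜ ≤ C / ((n : ℝ≥0) + 1)} := by
    intro n
    refine ⟨?_, fun k => ?_⟩
    · rw [← ENNReal.coe_le_coe, FiniteMeasure.ennreal_mass]
      exact hC0 n
    · rw [le_div_iff₀ (by positivity), mul_comm, ← ENNReal.coe_le_coe, ENNReal.coe_mul,
        FiniteMeasure.ennreal_coeFn_eq_coeFn_toMeasure]
      refine le_trans ?_ (hC1 n)
      rw [fmmM1_univ]
      refine le_trans ?_ (mul_meas_ge_le_lintegral (μ := (u n).1)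
        (f := fun x : ℝ≥0 => (x : ENNReal)) (by fun_prop) ((k + 1 : ℝ≥0) : ENNReal))
      refine mul_le_mul_right (measure_mono ?_) _
      intro x hx
      have : ¬ x ≤ (k : ℝ≥0) + 1 := fun hxk => hx ⟨zero_le, hxk⟩
      exact ENNReal.coe_le_coe.2 (not_le.1 this).le
  obtain ⟨ν, -, hν⟩ := hcpt.ultrafilter_le_nhds' ((hyperfilter ℕ).map v)
    (Ultrafilter.mem_map.2 (univ_mem' hmem))
  have hlim : Tendsto v (hyperfilter ℕ : Filter ℕ) (𝓝 ν) := hν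
  have hLP0 : ∀ (q : FirstMomentMeasures) (r : ℝ), (∀ᶠ n in atTop, dist (u n) q < r) →
      levyProkhorovEDist (ν : Measure ℝ≥0) q.1 ≤ ENNReal.ofReal r := by
    intro q r h
    refine fmm_lsc (hyperfilter ℕ : Filter ℕ) (fun n => (u n).1) _ _ _ ENNReal.ofReal_ne_top
      (fun E R _ δ hδ => FiniteMeasure.tendsto_iff_forall_lintegral_tendsto.1 hlim _) ?_
    filter_upwards [Nat.hyperfilter_le_atTop h] with n hn using (split hn).1
  have hLP1 : ∀ (q : FirstMomentMeasures) (r : ℝ), (∀ᶠ n in atTop, dist (u n) q < r) →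
      levyProkhorovEDist ((ν : Measure ℝ≥0).withDensity fun x : ℝ≥0 => (x : ENNReal)) (fmmM1 q)
        ≤ ENNReal.ofReal r := by
    intro q r h
    refine fmm_lsc (hyperfilter ℕ : Filter ℕ) (fun n => fmmM1 (u n)) _ _ _ ENNReal.ofReal_ne_top
      (fun E R hE δ hδ => fmm_conv_withDensity _ _ _ hlim E R hE δ hδ) ?_
    filter_upwards [Nat.hyperfilter_le_atTop h] with n hn using (split hn).2
  have hmom : (∫⁻ x, (x : ENNReal) ∂(ν : Measure ℝ≥0)) < ⊤ := by
    have h1 := hLP1 (u 0) R (Eventually.of_forall fun n => hbd n 0)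
    have h2 := fmm_univ_le _ _ (h1.trans_lt (ENNReal.ofReal_lt_ofReal_iff (by linarith)
      |>.2 (lt_add_one R)))
    rw [withDensity_apply _ MeasurableSet.univ, Measure.restrict_univ] at h2
    exact h2.trans_lt (by finiteness)
  let a : FirstMomentMeasures := ⟨(ν : Measure ℝ≥0), inferInstance, hmom⟩
  refine ⟨a, ?_⟩
  rw [Metric.tendsto_atTop]
  intro ε hε
  obtain ⟨N, hN⟩ := Metric.cauchySeq_iff.1 hu (ε / 4) (by positivity)
  refine ⟨N, fun n hn => ?_⟩
  have hev : ∀ᶠ m in atTop, dist (u m) (u n) < ε / 4 :=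
    eventually_atTop.2 ⟨N, fun m hm => hN m hm n hn⟩
  have h0 : levyProkhorovDist a.1 (u n).1 ≤ ε / 4 :=
    ENNReal.toReal_le_of_le_ofReal (by positivity) (hLP0 _ _ hev)
  have h1 : levyProkhorovDist (fmmM1 a) (fmmM1 (u n)) ≤ ε / 4 :=
    ENNReal.toReal_le_of_le_ofReal (by positivity) (hLP1 _ _ hev)
  rw [dist_comm]
  change LPmomentDist a (u n) < ε
  rw [fmm_dist_def]
  linarith

lemma fmm_separable : @TopologicalSpace.SeparableSpace FirstMomentMeasures
    fmmMetric.toUniformSpace.toTopologicalSpace := by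
  let _ := fmmMetric
  have : SecondCountableTopology FirstMomentMeasures := by
    apply Metric.secondCountable_of_countable_discretization
    intro ε hε
    have h2 : 0 < (ε / 2).toNNReal := Real.toNNReal_pos.2 (by positivity)
    obtain ⟨G, hG⟩ := fmm_discr _ h2
    refine ⟨List ℕ × List ℕ, inferInstance,
      fun p => (G ⟨p.1, fmm_fin0 p⟩, G ⟨fmmM1 p, fmm_fin1 p⟩), fun p q hpq => ?_⟩
    have e := Prod.ext_iff.1 hpq
    have h0 : levyProkhorovDist p.1 q.1 ≤ ε / 2 :=
      ENNReal.toReal_le_of_le_ofReal (by positivity) (hG _ _ e.1)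
    have h1 : levyProkhorovDist (fmmM1 p) (fmmM1 q) ≤ ε / 2 :=
      ENNReal.toReal_le_of_le_ofReal (by positivity) (hG _ _ e.2)
    change LPmomentDist p q ≤ ε
    rw [fmm_dist_def]
    linarith
  infer_instance

theorem LPmomentDist_metric_complete_separable :
    ∃ m : MetricSpace FirstMomentMeasures,
      (∀ p q : FirstMomentMeasures, m.toDist.dist p q = LPmomentDist p q) ∧
      @CompleteSpace FirstMomentMeasures m.toUniformSpace ∧
      @TopologicalSpace.SeparableSpace FirstMomentMeasures
        m.toUniformSpace.toTopologicalSpace := by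
  exact ⟨fmmMetric, fun _ _ => rfl, fmm_complete, fmm_separable⟩
end
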